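/- Let δ_k = (k, k−1, …, 2, 1) denote the staircase partition. For every k ≥ 3, the events s_{δ_k} ↦ 0 and s_{δ_{k−2}} ↦ 0 are independent; explicitly, P(s_{δ_k} ↦ 0 and s_{δ_{k−2}} ↦ 0) = 1/q², equivalently P(s_{δ_k} ↦ 0 | s_{δ_{k−2}} ↦ 0) = 1/q. -/

import Mathlib

open Finset Classical

/-- The Jacobi–Trudi matrix of a partition with `k` parts `lam 0 ≥ lam 1 ≥ …`,
with respect to a 1-indexed assignment `a : ℕ → F` of values to `h_1, h_2, …`.
The `(i,j)` entry (indices `0`-based) is `a (lam i - i + j)` if that subscript is `≥ 1`,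
is `1` if it is `0`, and is `0` if it is negative. -/
def JTmat (F : Type*) [Field F] (k : ℕ) (lam : ℕ → ℕ) (a : ℕ → F) :
    Matrix (Fin k) (Fin k) F :=
  Matrix.of fun i j =>
    if 1 ≤ (lam i : ℤ) - (i : ℤ) + (j : ℤ) then
      a ((lam i : ℤ) - (i : ℤ) + (j : ℤ)).toNat
    else if (lam i : ℤ) - (i : ℤ) + (j : ℤ) = 0 then 1 else 0

/-- Extend a tuple `b : Fin N → F` to a `1`-indexed assignment `ℕ → F`
(zero outside `{1, …, N}`). -/
def extFin {F : Type*} [Zero F] {N : ℕ} (b : Fin N → F) : ℕ → F :=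
  fun n => if h : 1 ≤ n ∧ n ≤ N then b ⟨n - 1, by omega⟩ else 0

/-- The probability that the Jacobi–Trudi determinant of the partition `lam`
(with `k` parts) equals `c`, when the values of `h_1, …, h_N` are chosen
uniformly at random in `F`. -/
noncomputable def probEq (F : Type*) [Field F] [Fintype F]
    (k : ℕ) (lam : ℕ → ℕ) (N : ℕ) (c : F) : ℚ :=
  ((Finset.univ.filter fun b : Fin N → F =>
      (JTmat F k lam (extFin b)).det = c).card : ℚ) / (Fintype.card F : ℚ) ^ N

/-- `lam` records a partition with `k` (positive, weakly decreasing) parts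
on the indices `0, …, k-1`. -/
def IsPartition (k : ℕ) (lam : ℕ → ℕ) : Prop :=
  (∀ i, i + 1 < k → lam (i + 1) ≤ lam i) ∧ ∀ i, i < k → 1 ≤ lam i

/-- The joint probability that the Jacobi–Trudi determinants of two partitions
both vanish, with `h_1, …, h_N` chosen uniformly at random. -/
noncomputable def probJoint2 (F : Type*) [Field F] [Fintype F]
    (k1 : ℕ) (lam1 : ℕ → ℕ) (k2 : ℕ) (lam2 : ℕ → ℕ) (N : ℕ) : ℚ :=
  ((Finset.univ.filter fun b : Fin N → F =>
      (JTmat F k1 lam1 (extFin b)).det = 0 ∧ (JTmat F k2 lam2 (extFin b)).det = 0).card : ℚ) /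
    (Fintype.card F : ℚ) ^ N

/-- The `a × b` Hankel matrix of the sequence `d`. -/
def hankelMat {F : Type*} (a b : ℕ) (d : ℕ → F) : Matrix (Fin a) (Fin b) F :=
  Matrix.of fun i j => d (i + j)

/-- The sequence extending a tuple by zero. -/
def seqOfFin {F : Type*} [Zero F] {N : ℕ} (c : Fin N → F) : ℕ → F :=
  fun n => if h : n < N then c ⟨n, h⟩ else 0

/-- Padding a tuple with a final zero, as a linear map. -/
def snocZero (F : Type*) [Field F] (b : ℕ) : (Fin b → F) →ₗ[F] (Fin (b + 1) → F) where
  toFun v := Fin.snoc (α := fun _ => F) v 0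
  map_add' u v := by
    ext j
    refine Fin.lastCases ?_ (fun j => ?_) j <;> simp
  map_smul' r v := by
    ext j
    refine Fin.lastCases ?_ (fun j => ?_) j <;> simp

section Hankel

variable {F : Type*} [Field F]

theorem snocZero_castSucc {b : ℕ} (v : Fin b → F) (j : Fin b) :
    snocZero F b v j.castSucc = v j := by
  simp [snocZero]

theorem snocZero_last {b : ℕ} (v : Fin b → F) : snocZero F b v (Fin.last b) = 0 := by
  simp [snocZero]

theorem snocZero_injective (b : ℕ) : Function.Injective (snocZero F b) := by
  intro u v h
  ext j
  simpa [snocZero_castSucc] using congrFun h j.castSucc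

theorem hankelMat_mulVec_snocZero (a b : ℕ) (d : ℕ → F) (v : Fin b → F) (i : Fin a) :
    (hankelMat a (b + 1) d).mulVec (snocZero F b v) i =
      (hankelMat (a + 1) b d).mulVec v i.castSucc := by
  simp [Matrix.mulVec, dotProduct, Fin.sum_univ_castSucc, snocZero_castSucc, snocZero_last,
    hankelMat]

theorem hankelMat_mulVec_cons (a b : ℕ) (d : ℕ → F) (v : Fin b → F) (i : Fin a) :
    (hankelMat a (b + 1) d).mulVec (Fin.cons (α := fun _ => F) 0 v) i =
      (hankelMat (a + 1) b d).mulVec v i.succ := by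
  simp only [Matrix.mulVec, dotProduct, Fin.sum_univ_succ, hankelMat, Matrix.of_apply,
    Fin.cons_zero, Fin.cons_succ, Fin.val_succ, mul_zero, zero_add]
  simp only [add_right_comm, add_assoc]

/-- The right kernel of the `a × b` Hankel matrix of `d`. -/
def hankelKer (a b : ℕ) (d : ℕ → F) : Submodule F (Fin b → F) :=
  LinearMap.ker (hankelMat a b d).mulVecLin

theorem mem_hankelKer {a b : ℕ} {d : ℕ → F} {v : Fin b → F} :
    v ∈ hankelKer a b d ↔ (hankelMat a b d).mulVec v = 0 := by
  simp [hankelKer]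

theorem snocZero_map_hankelKer_le (a b : ℕ) (d : ℕ → F) :
    (hankelKer (a + 1) b d).map (snocZero F b) ≤ hankelKer a (b + 1) d := by
  rintro _ ⟨v, hv, rfl⟩
  rw [SetLike.mem_coe, mem_hankelKer] at hv
  rw [mem_hankelKer]
  ext i
  rw [hankelMat_mulVec_snocZero, hv]
  rfl

theorem cons_mem_hankelKer {a b : ℕ} {d : ℕ → F} {v : Fin b → F}
    (hv : v ∈ hankelKer (a + 1) b d) :
    (Fin.cons (α := fun _ => F) 0 v : Fin (b + 1) → F) ∈ hankelKer a (b + 1) d := by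
  rw [mem_hankelKer] at hv ⊢
  ext i
  rw [hankelMat_mulVec_cons, hv]
  rfl

theorem snocZero_map_hankelKer_ne {a b : ℕ} {d : ℕ → F} (h : hankelKer (a + 1) b d ≠ ⊥) :
    (hankelKer (a + 1) b d).map (snocZero F b) ≠ hankelKer a (b + 1) d := by
  intro hW
  apply h
  have key : ∀ t : ℕ, ∀ v ∈ hankelKer (a + 1) b d, ∀ j : Fin b, b ≤ j + 1 + t → v j = 0 := by
    intro t
    induction t with
    | zero =>
      intro v hv j hj
      have hc := cons_mem_hankelKer hv
      rw [← hW] at hc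
      obtain ⟨u, -, hu⟩ := hc
      have hlast : j.succ = Fin.last b := by
        ext; simp; omega
      have := congrFun hu j.succ
      rw [Fin.cons_succ, hlast, snocZero_last] at this
      exact this.symm
    | succ t ih =>
      intro v hv j hj
      by_cases hjb : (j : ℕ) + 1 < b
      · have hc := cons_mem_hankelKer hv
        rw [← hW] at hc
        obtain ⟨u, hu', hu⟩ := hc
        have hs : j.succ = Fin.castSucc ⟨j + 1, hjb⟩ := by
          ext; simp
        have := congrFun hu j.succ
        rw [Fin.cons_succ, hs, snocZero_castSucc, ih u hu' _ (by simp; omega)] at this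
        exact this.symm
      · exact ih v hv j (by omega)
  rw [Submodule.eq_bot_iff]
  intro v hv
  ext j
  exact key b v hv j (by omega)

theorem finrank_hankelKer_le (a b : ℕ) (d : ℕ → F) :
    Module.finrank F (hankelKer (a + 1) b d) ≤ Module.finrank F (hankelKer a (b + 1) d) := by
  rw [(Submodule.equivMapOfInjective _ (snocZero_injective b)
    (hankelKer (a + 1) b d)).finrank_eq]
  exact Submodule.finrank_mono (snocZero_map_hankelKer_le a b d)

theorem finrank_hankelKer_lt {a b : ℕ} {d : ℕ → F} (h : hankelKer (a + 1) b d ≠ ⊥) :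
    Module.finrank F (hankelKer (a + 1) b d) < Module.finrank F (hankelKer a (b + 1) d) := by
  rw [(Submodule.equivMapOfInjective _ (snocZero_injective b)
    (hankelKer (a + 1) b d)).finrank_eq]
  exact Submodule.finrank_lt_finrank_of_lt
    (lt_of_le_of_ne (snocZero_map_hankelKer_le a b d) (snocZero_map_hankelKer_ne h))

theorem rank_add_finrank_hankelKer (a b : ℕ) (d : ℕ → F) :
    (hankelMat a b d).rank + Module.finrank F (hankelKer a b d) = b :=
  (hankelMat a b d).mulVecLin.finrank_range_add_finrank_ker.trans (Module.finrank_fin_fun F)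

theorem finrank_hankelKer_add_comm (a b : ℕ) (d : ℕ → F) :
    Module.finrank F (hankelKer a b d) + a = Module.finrank F (hankelKer b a d) + b := by
  have h : (hankelMat b a d) = (hankelMat a b d).transpose := by
    ext i j
    simp [hankelMat, add_comm]
  have h1 := rank_add_finrank_hankelKer a b d
  have h2 := rank_add_finrank_hankelKer b a d
  rw [h, Matrix.rank_transpose] at h2
  omega

theorem finrank_hankelKer_of_eq_bot {n : ℕ} {d : ℕ → F} (h : hankelKer (n + 1) (n + 1) d = ⊥) :
    Module.finrank F (hankelKer n (n + 2) d) = 2 := by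
  have h1 : Module.finrank F (hankelKer (n + 2) n d) ≤ _ := finrank_hankelKer_le (n + 1) n d
  have h2 := finrank_hankelKer_add_comm n (n + 2) d
  rw [h, finrank_bot] at h1
  omega

theorem finrank_hankelKer_of_ne_bot {n : ℕ} {d : ℕ → F} (h : hankelKer (n + 1) (n + 1) d ≠ ⊥) :
    Module.finrank F (hankelKer n (n + 2) d) =
      Module.finrank F (hankelKer (n + 1) (n + 1) d) + 1 := by
  have h1 : _ < Module.finrank F (hankelKer n (n + 2) d) := finrank_hankelKer_lt h
  have h2 := finrank_hankelKer_add_comm n (n + 2) d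
  have h3 : Module.finrank F (hankelKer (n + 2) n d) <
      Module.finrank F (hankelKer (n + 1) (n + 1) d) := by
    by_cases h0 : hankelKer (n + 2) n d = ⊥
    · rw [h0, finrank_bot]
      exact Nat.pos_of_ne_zero fun h' => h (Submodule.finrank_eq_zero.1 h')
    · exact finrank_hankelKer_lt h0
  omega

theorem hankelKer_eq_bot_iff {n : ℕ} {d : ℕ → F} :
    hankelKer n n d = ⊥ ↔ (hankelMat n n d).det ≠ 0 := by
  rw [Ne, ← Matrix.exists_mulVec_eq_zero_iff, Submodule.eq_bot_iff]
  simp only [mem_hankelKer]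
  push Not
  exact ⟨fun h v hv h0 => hv (h v h0), fun h v h0 => by_contra fun hv => h v hv h0⟩

/-- The linear map sending the defining tuple of a Hankel matrix to its product with `v`. -/
def hankelEval (N a : ℕ) {b : ℕ} (v : Fin b → F) : (Fin N → F) →ₗ[F] (Fin a → F) where
  toFun c := (hankelMat a b (seqOfFin c)).mulVec v
  map_add' c c' := by
    ext i
    simp only [Matrix.mulVec, dotProduct, hankelMat, Matrix.of_apply, Pi.add_apply,
      ← Finset.sum_add_distrib, ← add_mul]
    refine Finset.sum_congr rfl fun j _ => ?_
    unfold seqOfFin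
    split_ifs <;> simp
  map_smul' r c := by
    ext i
    simp only [Matrix.mulVec, dotProduct, hankelMat, Matrix.of_apply, Pi.smul_apply,
      RingHom.id_apply, smul_eq_mul, Finset.mul_sum, ← mul_assoc]
    refine Finset.sum_congr rfl fun j _ => ?_
    unfold seqOfFin
    split_ifs <;> simp

theorem seqOfFin_single {N : ℕ} (n : Fin N) (t : ℕ) :
    seqOfFin (Pi.single n (1 : F)) t = if t = n then 1 else 0 := by
  unfold seqOfFin
  split_ifs with h1 h2 h2
  · subst h2; simp
  · rw [Pi.single_eq_of_ne]
    intro h; exact h2 (by simpa using congrArg Fin.val h)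
  · exact absurd (h2 ▸ n.2) h1
  · rfl

theorem ofFn_eq_sum_monomial {m : ℕ} (w : Fin m → F) :
    Polynomial.ofFn m w = ∑ i : Fin m, Polynomial.monomial (i : ℕ) (w i) := by
  ext t
  rw [Polynomial.finsetSum_coeff]
  simp only [Polynomial.coeff_monomial]
  by_cases ht : t < m
  · rw [Polynomial.ofFn_coeff_eq_val_of_lt _ ht, Finset.sum_eq_single ⟨t, ht⟩]
    · simp
    · intro i _ hi
      rw [if_neg]
      exact fun h => hi (Fin.ext h)
    · simp
  · rw [Polynomial.ofFn_coeff_eq_zero_of_ge _ (not_lt.1 ht)]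
    exact (Finset.sum_eq_zero fun i _ => if_neg (by omega)).symm

theorem ofFn_injective (m : ℕ) : Function.Injective (Polynomial.ofFn (R := F) m) := by
  intro w w' h
  ext i
  rw [← Polynomial.ofFn_coeff_eq_val_of_lt w i.2, h, Polynomial.ofFn_coeff_eq_val_of_lt]

theorem hankelEval_surjective {N a b : ℕ} (hN : a + b ≤ N + 1) {v : Fin b → F} (hv : v ≠ 0) :
    Function.Surjective (hankelEval N a v) := by
  by_contra hs
  rw [← LinearMap.range_eq_top] at hs
  obtain ⟨f, hf, hle⟩ := Submodule.exists_le_ker_of_lt_top _ (lt_top_iff_ne_top.2 hs)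
  set y : Fin a → F := fun i => f (Pi.single i 1) with hy
  have hfy : ∀ w : Fin a → F, f w = ∑ i, w i * y i := by
    intro w
    conv_lhs => rw [pi_eq_sum_univ' w]
    simp [hy]
  have hprod : Polynomial.ofFn a y * Polynomial.ofFn b v = 0 := by
    ext n
    rw [Polynomial.coeff_zero]
    rw [ofFn_eq_sum_monomial, ofFn_eq_sum_monomial, Finset.sum_mul_sum, Polynomial.finsetSum_coeff]
    simp only [Polynomial.finsetSum_coeff, Polynomial.monomial_mul_monomial,
      Polynomial.coeff_monomial]
    by_cases hn : n < N
    · have h0 : f (hankelEval N a v (Pi.single ⟨n, hn⟩ 1)) = 0 := hle ⟨_, rfl⟩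
      rw [hfy] at h0
      refine Eq.trans ?_ h0
      refine Finset.sum_congr rfl fun i _ => ?_
      simp only [hankelEval, LinearMap.coe_mk, AddHom.coe_mk, Matrix.mulVec, dotProduct,
        hankelMat, Matrix.of_apply, seqOfFin_single, Finset.sum_mul]
      refine Finset.sum_congr rfl fun j _ => ?_
      split_ifs <;> ring
    · refine Finset.sum_eq_zero fun i _ => Finset.sum_eq_zero fun j _ => if_neg ?_
      omega
  rcases mul_eq_zero.1 hprod with h | h
  · apply hf
    refine LinearMap.ext fun w => ?_
    rw [hfy, ofFn_injective _ (h.trans (map_zero _).symm)]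
    simp
  · exact hv (ofFn_injective _ (h.trans (map_zero _).symm))

end Hankel

section Counting

theorem card_filter_comp_mul_card {G H E : Type*} [AddGroup G] [Fintype G] [AddGroup H]
    [Fintype H] [FunLike E G H] [AddMonoidHomClass E G H] (f : E) (hf : Function.Surjective f)
    (p : H → Prop) :
    (univ.filter fun g => p (f g)).card * Fintype.card H =
      (univ.filter p).card * Fintype.card G := by
  have hfib : ∀ y : H, (univ.filter fun g => f g = y).card =
      (univ.filter fun g => f g = 0).card := fun y =>
    AddMonoidHom.card_fiber_eq_of_mem_range f (hf y) (hf 0)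
  have h1 : ∀ p : H → Prop, (univ.filter fun g => p (f g)).card =
      (univ.filter p).card * (univ.filter fun g => f g = 0).card := by
    intro p
    rw [Finset.card_eq_sum_card_fiberwise (f := f) (t := univ.filter p)
      (fun g hg => by simpa using hg), Finset.sum_const_nat]
    intro y hy
    rw [← hfib y, Finset.filter_filter]
    congr 1
    ext g
    simp only [Finset.mem_filter, Finset.mem_univ, true_and] at hy ⊢
    exact ⟨fun h => h.2, fun h => ⟨h ▸ hy, h⟩⟩
  have h2 := h1 fun _ => True
  simp only [Finset.filter_true, Finset.card_univ] at h2
  rw [h1 p, h2]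
  ring

variable {F : Type*} [Field F] [Fintype F]

theorem card_filter_mulVec_eq_zero (a b : ℕ) (d : ℕ → F) :
    (univ.filter fun v : Fin b → F => (hankelMat a b d).mulVec v = 0).card =
      Fintype.card F ^ Module.finrank F (hankelKer a b d) := by
  rw [← Module.card_eq_pow_finrank, Fintype.card_subtype]
  simp only [mem_hankelKer]

theorem card_filter_hankelEval_eq_zero {N a b : ℕ} (ha : a ≤ N) (hN : a + b ≤ N + 1)
    {v : Fin b → F} (hv : v ≠ 0) :
    (univ.filter fun c : Fin N → F => (hankelMat a b (seqOfFin c)).mulVec v = 0).card =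
      Fintype.card F ^ (N - a) := by
  have h := card_filter_comp_mul_card (hankelEval N a v) (hankelEval_surjective hN hv) (· = 0)
  have h1 : ∀ _ : DecidablePred fun w : Fin a → F => w = 0,
      (univ.filter fun w : Fin a → F => w = 0).card = 1 := by
    intro _
    rw [Finset.card_eq_one]
    exact ⟨0, by ext; simp⟩
  rw [h1, Fintype.card_fun, Fintype.card_fun, Fintype.card_fin, Fintype.card_fin, one_mul] at h
  have hq : 0 < Fintype.card F ^ a := pow_pos Fintype.card_pos a
  refine Nat.eq_of_mul_eq_mul_right hq ?_
  rw [← pow_add, Nat.sub_add_cancel ha, ← h]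
  congr!

theorem sum_card_pow_finrank_hankelKer {N a b : ℕ} (ha : a ≤ N) (hN : a + b ≤ N + 1) :
    (∑ c : Fin N → F, Fintype.card F ^ Module.finrank F (hankelKer a b (seqOfFin c))) +
        Fintype.card F ^ (N - a) =
      Fintype.card F ^ N + Fintype.card F ^ b * Fintype.card F ^ (N - a) := by
  simp only [← card_filter_mulVec_eq_zero]
  have h := Finset.sum_card_bipartiteAbove_eq_sum_card_bipartiteBelow (s := univ) (t := univ)
    fun (c : Fin N → F) (v : Fin b → F) => (hankelMat a b (seqOfFin c)).mulVec v = 0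
  simp only [Finset.bipartiteAbove, Finset.bipartiteBelow] at h
  rw [h, ← Finset.add_sum_erase _ _ (Finset.mem_univ (0 : Fin b → F)),
    Finset.sum_congr rfl fun v hv =>
      card_filter_hankelEval_eq_zero ha hN (Finset.ne_of_mem_erase hv),
    Finset.sum_const, Finset.card_erase_of_mem (Finset.mem_univ _)]
  simp only [Matrix.mulVec_zero, Finset.filter_true, Finset.card_univ, Fintype.card_fun,
    Fintype.card_fin, smul_eq_mul]
  have hq : 0 < Fintype.card F ^ b := pow_pos Fintype.card_pos b
  obtain ⟨r, hr⟩ : ∃ r, Fintype.card F ^ b = r + 1 := ⟨_, (Nat.sub_add_cancel hq).symm⟩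
  rw [hr, Nat.add_sub_cancel]
  ring

theorem card_hankelMat_det_eq_zero (n : ℕ) :
    Fintype.card F * (univ.filter fun c : Fin (2 * n + 1) → F =>
        (hankelMat (n + 1) (n + 1) (seqOfFin c)).det = 0).card =
      Fintype.card F ^ (2 * n + 1) := by
  have h1 := sum_card_pow_finrank_hankelKer (F := F) (N := 2 * n + 1) (a := n + 1) (b := n + 1)
    (by omega) (by omega)
  have h2 := sum_card_pow_finrank_hankelKer (F := F) (N := 2 * n + 1) (a := n) (b := n + 2)
    (by omega) (by omega)
  have hcard : (univ.filter fun c : Fin (2 * n + 1) → F =>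
        (hankelMat (n + 1) (n + 1) (seqOfFin c)).det = 0).card +
      (univ.filter fun c : Fin (2 * n + 1) → F =>
        ¬(hankelMat (n + 1) (n + 1) (seqOfFin c)).det = 0).card =
      Fintype.card F ^ (2 * n + 1) := by
    rw [Finset.card_filter_add_card_filter_not, Finset.card_univ, Fintype.card_fun,
      Fintype.card_fin]
  rw [← Finset.sum_filter_add_sum_filter_not _
    fun c : Fin (2 * n + 1) → F => (hankelMat (n + 1) (n + 1) (seqOfFin c)).det = 0] at h1 h2
  have hreg : ∀ c ∈ univ.filter fun c : Fin (2 * n + 1) → F =>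
      ¬(hankelMat (n + 1) (n + 1) (seqOfFin c)).det = 0,
      hankelKer (n + 1) (n + 1) (seqOfFin c) = ⊥ := fun c hc =>
    hankelKer_eq_bot_iff.2 (Finset.mem_filter.1 hc).2
  have hsing : ∀ c ∈ univ.filter fun c : Fin (2 * n + 1) → F =>
      (hankelMat (n + 1) (n + 1) (seqOfFin c)).det = 0,
      hankelKer (n + 1) (n + 1) (seqOfFin c) ≠ ⊥ := fun c hc h =>
    hankelKer_eq_bot_iff.1 h (Finset.mem_filter.1 hc).2
  rw [Finset.sum_congr rfl fun c hc => by rw [finrank_hankelKer_of_ne_bot (hsing c hc), pow_succ],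
    Finset.sum_congr (s₁ := univ.filter fun c : Fin (2 * n + 1) → F =>
      ¬(hankelMat (n + 1) (n + 1) (seqOfFin c)).det = 0) rfl
      fun c hc => by rw [finrank_hankelKer_of_eq_bot (hreg c hc)],
    ← Finset.sum_mul, Finset.sum_const, smul_eq_mul, show 2 * n + 1 - n = n + 1 by omega] at h2
  rw [Finset.sum_congr (s₁ := univ.filter fun c : Fin (2 * n + 1) → F =>
      ¬(hankelMat (n + 1) (n + 1) (seqOfFin c)).det = 0) rfl
      fun c hc => by rw [hreg c hc, finrank_bot, pow_zero],
    Finset.sum_const, smul_eq_mul, show 2 * n + 1 - (n + 1) = n by omega] at h1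
  have hq : 1 < Fintype.card F := Fintype.one_lt_card
  generalize (univ.filter fun c : Fin (2 * n + 1) → F =>
    (hankelMat (n + 1) (n + 1) (seqOfFin c)).det = 0).card = s at *
  generalize (univ.filter fun c : Fin (2 * n + 1) → F =>
    ¬(hankelMat (n + 1) (n + 1) (seqOfFin c)).det = 0).card = r at *
  generalize (∑ c : Fin (2 * n + 1) → F with
    (hankelMat (n + 1) (n + 1) (seqOfFin c)).det = 0,
      Fintype.card F ^ Module.finrank F (hankelKer (n + 1) (n + 1) (seqOfFin c))) = X at *
  generalize Fintype.card F = q at *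
  have e1 : q ^ (2 * n + 1) = q * (q ^ n) ^ 2 := by ring
  have e2 : q ^ (n + 1) = q * q ^ n := by ring
  have e3 : q ^ (n + 2) = q ^ 2 * q ^ n := by ring
  rw [e1] at h1 h2 hcard ⊢
  rw [e2] at h1 h2
  rw [e3] at h2
  generalize q ^ n = u at *
  zify at *
  have hq0 : (q : ℤ) * (q - 1) ≠ 0 := mul_ne_zero (by omega) (by omega)
  refine mul_left_cancel₀ hq0 ?_
  linear_combination (q : ℤ) * (q * (q - 1)) * hcard + (q : ℤ) ^ 2 * h1 - q * h2

end Counting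

section Hurwitz

open PowerSeries

variable {F : Type*} [Field F]

/-- The generating series of `1, h 2, h 4, …`. -/
noncomputable def evenSeries (h : ℕ → F) : F⟦X⟧ :=
  PowerSeries.mk fun l => if l = 0 then 1 else h (2 * l)

/-- The generating series of `h 1, h 3, h 5, …`. -/
noncomputable def oddSeries (h : ℕ → F) : F⟦X⟧ :=
  PowerSeries.mk fun l => h (2 * l + 1)

/-- The quotient of the odd by the even part of the generating series of `h`. -/
noncomputable def ratioSeries (h : ℕ → F) : F⟦X⟧ :=
  oddSeries h * (evenSeries h)⁻¹

theorem evenSeries_mul_inv (h : ℕ → F) : evenSeries h * (evenSeries h)⁻¹ = 1 := by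
  refine PowerSeries.mul_inv_cancel _ ?_
  simp [evenSeries, ← PowerSeries.coeff_zero_eq_constantCoeff_apply]

theorem ratioSeries_mul_evenSeries (h : ℕ → F) :
    ratioSeries h * evenSeries h = oddSeries h := by
  rw [ratioSeries, mul_assoc, mul_comm (evenSeries h)⁻¹, evenSeries_mul_inv, mul_one]

/-- The Hurwitz matrix of `h`, with the convention `h 0 = 1`. -/
def hurwitzMat (k : ℕ) (h : ℕ → F) : Matrix (Fin k) (Fin k) F :=
  Matrix.of fun i j =>
    if (j : ℕ) < 2 * i + 1 then h (2 * i + 1 - j) else if (j : ℕ) = 2 * i + 1 then 1 else 0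

theorem det_JTmat_staircase (k : ℕ) (h : ℕ → F) :
    (JTmat F k (fun i => k - i) h).det = (hurwitzMat k h).det := by
  rw [← Matrix.det_submatrix_equiv_self Fin.revPerm]
  congr 1
  ext i j
  have hi := i.2
  have hj := j.2
  simp only [JTmat, hurwitzMat, Matrix.submatrix_apply, Matrix.of_apply, Fin.revPerm_apply,
    Fin.val_rev]
  by_cases h1 : (j : ℕ) < 2 * i + 1
  · rw [if_pos h1, if_pos (by omega)]
    congr 1
    omega
  · rw [if_neg h1, if_neg (by omega)]
    exact if_congr (by omega) rfl rfl

theorem coeff_mul_oddSeries_add (h x : ℕ → F) (i : ℕ) :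
    PowerSeries.coeff i (PowerSeries.mk (fun s => x (2 * s)) * oddSeries h +
        PowerSeries.mk (fun s => x (2 * s + 1)) * evenSeries h) =
      ∑ j ∈ range (2 * (i + 1)), (if j < 2 * i + 1 then h (2 * i + 1 - j)
        else if j = 2 * i + 1 then 1 else 0) * x j := by
  have hsplit : ∀ (f : ℕ → F) (n : ℕ),
      ∑ j ∈ range (2 * n), f j = ∑ s ∈ range n, (f (2 * s) + f (2 * s + 1)) := by
    intro f n
    induction n with
    | zero => simp
    | succ n ih =>
      rw [Finset.sum_range_succ, ← ih, mul_add, mul_one, Finset.sum_range_succ,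
        Finset.sum_range_succ, add_assoc]
  rw [hsplit, map_add, PowerSeries.coeff_mul, PowerSeries.coeff_mul,
    Finset.Nat.sum_antidiagonal_eq_sum_range_succ_mk,
    Finset.Nat.sum_antidiagonal_eq_sum_range_succ_mk, ← Finset.sum_add_distrib]
  refine Finset.sum_congr rfl fun s hs => ?_
  have hs' : s ≤ i := Nat.lt_succ_iff.1 (Finset.mem_range.1 hs)
  simp only [PowerSeries.coeff_mk, oddSeries, evenSeries]
  rw [if_pos (by omega : 2 * s < 2 * i + 1), show 2 * (i - s) + 1 = 2 * i + 1 - 2 * s by omega,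
    mul_comm]
  congr 1
  rw [mul_comm]
  congr 1
  by_cases h0 : i - s = 0
  · rw [if_pos h0, if_neg (by omega), if_pos (by omega)]
  · rw [if_neg h0, if_pos (by omega), show 2 * (i - s) = 2 * i + 1 - (2 * s + 1) by omega]

theorem hurwitzMat_mulVec (k : ℕ) (h x : ℕ → F) (hx : ∀ j, k ≤ j → x j = 0) (i : Fin k) :
    (hurwitzMat k h).mulVec (fun j => x j) i =
      PowerSeries.coeff (i : ℕ) (PowerSeries.mk (fun s => x (2 * s)) * oddSeries h +
        PowerSeries.mk (fun s => x (2 * s + 1)) * evenSeries h) := by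
  rw [coeff_mul_oddSeries_add]
  simp only [Matrix.mulVec, dotProduct, hurwitzMat, Matrix.of_apply]
  rw [Fin.sum_univ_eq_sum_range fun j => (if j < 2 * (i : ℕ) + 1 then h (2 * i + 1 - j)
        else if j = 2 * (i : ℕ) + 1 then 1 else 0) * x j]
  trans ∑ j ∈ range (k + 2 * (i + 1)), (if j < 2 * (i : ℕ) + 1 then h (2 * i + 1 - j)
        else if j = 2 * (i : ℕ) + 1 then 1 else 0) * x j
  · refine Finset.sum_subset (Finset.range_mono (by omega)) fun j _ hj => ?_
    rw [hx j (by simpa using hj), mul_zero]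
  · refine (Finset.sum_subset (Finset.range_mono (by omega)) fun j _ hj => ?_).symm
    rw [Finset.mem_range] at hj
    rw [if_neg (by omega), if_neg (by omega), zero_mul]

theorem exists_mulVec_seq_iff {k : ℕ} (A : Matrix (Fin k) (Fin k) F) :
    A.det = 0 ↔ ∃ x : ℕ → F, x ≠ 0 ∧ (∀ j, k ≤ j → x j = 0) ∧
      ∀ i, A.mulVec (fun j => x j) i = 0 := by
  rw [← Matrix.exists_mulVec_eq_zero_iff]
  constructor
  · rintro ⟨v, hv, hA⟩
    have hv' : (fun j : Fin k => seqOfFin v j) = v := by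
      ext j
      simp [seqOfFin]
    refine ⟨seqOfFin v, fun h => hv ?_, fun j hj => dif_neg (not_lt.2 hj), fun i => ?_⟩
    · rw [← hv', h]
      rfl
    · rw [hv', hA]
      rfl
  · rintro ⟨x, hx, hk, hA⟩
    refine ⟨fun j => x j, fun h => hx ?_, funext hA⟩
    ext j
    by_cases hj : j < k
    · exact congrFun h ⟨j, hj⟩
    · exact hk j (not_lt.1 hj)

theorem det_hurwitzMat_eq_zero_iff {k m n : ℕ} (hk : k = m + n) (h1 : n ≤ m) (h2 : m ≤ n + 1)
    (h : ℕ → F) :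
    (hurwitzMat k h).det = 0 ↔ ∃ p : ℕ → F, p ≠ 0 ∧ (∀ s, m ≤ s → p s = 0) ∧
      ∀ i, i < m → PowerSeries.coeff (n + i) (PowerSeries.mk p * ratioSeries h) = 0 := by
  rw [exists_mulVec_seq_iff]
  constructor
  · rintro ⟨x, hx, hxk, hA⟩
    have hdvd : (X : F⟦X⟧) ^ k ∣ PowerSeries.mk (fun s => x (2 * s)) * ratioSeries h +
        PowerSeries.mk (fun s => x (2 * s + 1)) := by
      have hd : (X : F⟦X⟧) ^ k ∣ PowerSeries.mk (fun s => x (2 * s)) * oddSeries h +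
        PowerSeries.mk (fun s => x (2 * s + 1)) * evenSeries h := by
        rw [PowerSeries.X_pow_dvd_iff]
        intro i hi
        rw [← hurwitzMat_mulVec k h x hxk ⟨i, hi⟩, hA]
      convert hd.mul_right (evenSeries h)⁻¹ using 1
      rw [add_mul, mul_assoc, mul_assoc, evenSeries_mul_inv, mul_one, ratioSeries]
    rw [PowerSeries.X_pow_dvd_iff] at hdvd
    refine ⟨fun s => x (2 * s), fun hp => hx ?_, fun s hs => hxk _ (by omega), fun i hi => ?_⟩
    · have hp0 : PowerSeries.mk (fun s => x (2 * s)) = 0 := by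
        ext s
        simpa using congrFun hp s
      rw [hp0] at hdvd
      ext j
      by_cases hj : j < k
      · rcases Nat.even_or_odd' j with ⟨s, rfl | rfl⟩
        · exact congrFun hp s
        · simpa using hdvd s (by omega)
      · exact hxk j (not_lt.1 hj)
    · have := hdvd (n + i) (by omega)
      rwa [map_add, PowerSeries.coeff_mk, hxk _ (by omega), add_zero] at this
  · rintro ⟨p, hp, hpm, hc⟩
    set x : ℕ → F := fun j => if j % 2 = 0 then p (j / 2) else
      if j / 2 < n then -PowerSeries.coeff (j / 2) (PowerSeries.mk p * ratioSeries h) else 0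
      with hxdef
    have hx0 : ∀ s, x (2 * s) = p s := fun s => by simp [hxdef]
    have hx1 : ∀ s, x (2 * s + 1) = if s < n then
        -PowerSeries.coeff s (PowerSeries.mk p * ratioSeries h) else 0 := fun s => by
      have e1 : (2 * s + 1) % 2 = 1 := by omega
      have e2 : (2 * s + 1) / 2 = s := by omega
      simp [hxdef, e1, e2]
    have hxk : ∀ j, k ≤ j → x j = 0 := by
      intro j hj
      rcases Nat.even_or_odd' j with ⟨s, rfl | rfl⟩
      · rw [hx0, hpm s (by omega)]
      · rw [hx1, if_neg (by omega)]
    refine ⟨x, fun hx => hp ?_, hxk, fun i => ?_⟩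
    · ext s
      rw [← hx0, hx]
      rfl
    · rw [hurwitzMat_mulVec k h x hxk]
      have hd : (X : F⟦X⟧) ^ k ∣ PowerSeries.mk (fun s => x (2 * s)) * ratioSeries h +
          PowerSeries.mk (fun s => x (2 * s + 1)) := by
        rw [PowerSeries.X_pow_dvd_iff]
        intro i hi
        simp only [hx0, hx1]
        rw [map_add, PowerSeries.coeff_mk]
        by_cases hin : i < n
        · rw [if_pos hin, add_neg_cancel]
        · rw [if_neg hin, add_zero]
          have := hc (i - n) (by omega)
          rwa [Nat.add_sub_cancel' (not_lt.1 hin)] at this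
      have hd' := hd.mul_right (evenSeries h)
      rw [add_mul, mul_assoc, ratioSeries_mul_evenSeries, PowerSeries.X_pow_dvd_iff] at hd'
      exact hd' i i.2

theorem coeff_mul_eq_hankelMat_mulVec {m n : ℕ} (h2 : m ≤ n + 1) (c : F⟦X⟧) (p : ℕ → F)
    (hp : ∀ s, m ≤ s → p s = 0) (i : Fin m) :
    PowerSeries.coeff (n + i) (PowerSeries.mk p * c) =
      (hankelMat m m fun l => PowerSeries.coeff (n + 1 - m + l) c).mulVec
        (fun j => p (m - 1 - j)) i := by
  rw [PowerSeries.coeff_mul, Finset.Nat.sum_antidiagonal_eq_sum_range_succ_mk]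
  simp only [Matrix.mulVec, dotProduct, hankelMat, Matrix.of_apply, PowerSeries.coeff_mk]
  rw [Fin.sum_univ_eq_sum_range fun j =>
    PowerSeries.coeff (n + 1 - m + (i + j)) c * p (m - 1 - j), ← Finset.sum_range_reflect _ m,
    ← Finset.sum_subset (Finset.range_mono (show m ≤ (n + i).succ by omega))]
  · refine Finset.sum_congr rfl fun s hs => ?_
    have hs' := Finset.mem_range.1 hs
    rw [mul_comm, show m - 1 - (m - 1 - s) = s by omega,
      show n + 1 - m + (i + (m - 1 - s)) = n + i - s by omega]
  · intro s _ hs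
    rw [hp s (by simpa using hs), zero_mul]

theorem det_hurwitzMat_eq_zero_iff_hankelMat {k m n : ℕ} (hk : k = m + n) (h1 : n ≤ m)
    (h2 : m ≤ n + 1) (h : ℕ → F) :
    (hurwitzMat k h).det = 0 ↔
      (hankelMat m m fun l => PowerSeries.coeff (n + 1 - m + l) (ratioSeries h)).det = 0 := by
  rw [det_hurwitzMat_eq_zero_iff hk h1 h2, ← Matrix.exists_mulVec_eq_zero_iff]
  constructor
  · rintro ⟨p, hp, hpm, hc⟩
    refine ⟨fun j => p (m - 1 - j), fun hv => hp ?_, ?_⟩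
    · ext s
      by_cases hs : s < m
      · have := congrFun hv ⟨m - 1 - s, by omega⟩
        simpa [show m - 1 - (m - 1 - s) = s by omega] using this
      · exact hpm s (not_lt.1 hs)
    · ext i
      rw [← coeff_mul_eq_hankelMat_mulVec h2 _ p hpm i]
      exact hc i i.2
  · rintro ⟨v, hv, hA⟩
    set p : ℕ → F := seqOfFin fun j : Fin m => v j.rev with hpdef
    have hpm : ∀ s, m ≤ s → p s = 0 := fun s hs => dif_neg (not_lt.2 hs)
    have hpv : (fun j : Fin m => p (m - 1 - j)) = v := by
      ext j
      have hj := j.2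
      rw [hpdef, seqOfFin, dif_pos (by omega)]
      congr 1
      ext
      simp only [Fin.val_rev]
      omega
    refine ⟨p, fun hp => hv ?_, hpm, fun i hi => ?_⟩
    · rw [← hpv, hp]
      rfl
    · have := coeff_mul_eq_hankelMat_mulVec h2 (ratioSeries h) p hpm ⟨i, hi⟩
      rw [hpv, hA] at this
      exact this

/-- The substitution replacing the odd-indexed `h` by the coefficients of `ratioSeries`. -/
noncomputable def ratioSubst {N : ℕ} (b : Fin N → F) : Fin N → F := fun j =>
  if (j : ℕ) % 2 = 0 then PowerSeries.coeff ((j : ℕ) / 2) (ratioSeries (extFin b)) else b j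

theorem extFin_succ {N : ℕ} (b : Fin N → F) (j : Fin N) : extFin b (j + 1) = b j := by
  have hj := j.2
  rw [extFin, dif_pos (by omega)]
  rfl

theorem ratioSubst_injective (N : ℕ) :
    Function.Injective (ratioSubst : (Fin N → F) → Fin N → F) := by
  intro b b' hb
  have hodd : ∀ j : Fin N, (j : ℕ) % 2 = 1 → b j = b' j := by
    intro j hj
    have := congrFun hb j
    rwa [ratioSubst, ratioSubst, if_neg (by omega), if_neg (by omega)] at this
  have hE : evenSeries (extFin b) = evenSeries (extFin b') := by
    ext l
    simp only [evenSeries, PowerSeries.coeff_mk, extFin]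
    split_ifs with h0 h1
    · rfl
    · exact hodd _ (by simp only; omega)
    · rfl
  ext j
  by_cases hj : (j : ℕ) % 2 = 0
  · have hO : ∀ b : Fin N → F,
        PowerSeries.coeff ((j : ℕ) / 2) (oddSeries (extFin b)) = b j := by
      intro b
      rw [oddSeries, PowerSeries.coeff_mk, ← extFin_succ b j]
      congr 1
      omega
    rw [← hO b, ← hO b', ← ratioSeries_mul_evenSeries, ← ratioSeries_mul_evenSeries, hE,
      PowerSeries.coeff_mul, PowerSeries.coeff_mul]
    refine Finset.sum_congr rfl fun st hst => ?_
    have hst' := Finset.HasAntidiagonal.mem_antidiagonal.1 hst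
    have hj2 := j.2
    have := congrFun hb ⟨2 * st.1, by omega⟩
    simp only [ratioSubst, Nat.mul_mod_right, if_true] at this
    rw [Nat.mul_div_cancel_left _ two_pos] at this
    rw [this]
  · exact hodd j (by omega)

theorem card_det_JTmat_staircase_eq_zero [Fintype F] {k N : ℕ} (hk : 1 ≤ k)
    (hN : 2 * k - 1 ≤ N) :
    Fintype.card F * (univ.filter fun b : Fin N → F =>
        (JTmat F k (fun i => k - i) (extFin b)).det = 0).card = Fintype.card F ^ N := by
  obtain ⟨t, n, hkt, h1, h2⟩ : ∃ t n, k = (t + 1) + n ∧ n ≤ t + 1 ∧ t + 1 ≤ n + 1 :=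
    ⟨(k - 1) / 2, k / 2, by omega, by omega, by omega⟩
  let e : Fin (2 * t + 1) → Fin N := fun l => ⟨2 * (n - t + l), by omega⟩
  have he : Function.Injective e := by
    intro l l' hl
    have := congrArg Fin.val hl
    simp only [e] at this
    ext
    omega
  have hiff : ∀ b : Fin N → F, (JTmat F k (fun i => k - i) (extFin b)).det = 0 ↔
      (hankelMat (t + 1) (t + 1)
        (seqOfFin (LinearMap.funLeft F F e (ratioSubst b)))).det = 0 := by
    intro b
    rw [det_JTmat_staircase, det_hurwitzMat_eq_zero_iff_hankelMat hkt h1 h2]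
    have : (hankelMat (t + 1) (t + 1) fun l =>
        PowerSeries.coeff (n + 1 - (t + 1) + l) (ratioSeries (extFin b))) =
        hankelMat (t + 1) (t + 1) (seqOfFin (LinearMap.funLeft F F e (ratioSubst b))) := by
      ext i j
      have hi := i.2
      have hj := j.2
      simp only [hankelMat, Matrix.of_apply, seqOfFin, LinearMap.funLeft_apply, e, ratioSubst,
        Nat.mul_mod_right, if_true]
      rw [dif_pos (by omega), Nat.mul_div_cancel_left _ two_pos]
      congr 2
      omega
    rw [this]
  have hcard := card_filter_comp_mul_card (LinearMap.funLeft F F e)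
    (LinearMap.funLeft_surjective_of_injective F F e he)
    fun c => (hankelMat (t + 1) (t + 1) (seqOfFin c)).det = 0
  have hbij : (univ.filter fun b : Fin N → F =>
        (JTmat F k (fun i => k - i) (extFin b)).det = 0).card =
      (univ.filter fun x : Fin N → F => (hankelMat (t + 1) (t + 1)
        (seqOfFin (LinearMap.funLeft F F e x))).det = 0).card :=
    Finset.card_bijective ratioSubst
      (Finite.injective_iff_bijective.1 (ratioSubst_injective N)) fun b => by simp [hiff b]
  have hH := card_hankelMat_det_eq_zero (F := F) t
  simp only [Fintype.card_fun, Fintype.card_fin] at hcard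
  rw [hbij]
  have hq : 0 < Fintype.card F ^ (2 * t + 1) := pow_pos Fintype.card_pos _
  refine Nat.eq_of_mul_eq_mul_right hq ?_
  rw [mul_assoc, hcard, ← mul_assoc, hH, mul_comm]

end Hurwitz

section Skip

variable {F : Type*} [Field F]

theorem det_hurwitzMat_submatrix (l : ℕ) (h : ℕ → F) :
    ((hurwitzMat (l + 2) h).submatrix (Fin.last (l + 1)).succAbove Fin.succ).det =
      (hurwitzMat l h).det := by
  rw [Matrix.det_succ_row_zero, Fin.sum_univ_succ, Finset.sum_eq_zero fun j _ => ?_, add_zero]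
  · simp only [Fin.succAbove_last, Matrix.submatrix_apply, Matrix.submatrix_submatrix]
    rw [show hurwitzMat (l + 2) h (Fin.castSucc 0) (Fin.succ 0) = 1 by simp [hurwitzMat]]
    simp only [Fin.val_zero, pow_zero, one_mul]
    congr 1
    ext i j
    simp only [hurwitzMat, Matrix.submatrix_apply, Matrix.of_apply, Function.comp_apply,
      Fin.val_castSucc, Fin.val_succ, Fin.succAbove_zero]
    rw [show 2 * ((i : ℕ) + 1) + 1 - (j + 1 + 1) = 2 * i + 1 - j by omega]
    exact if_congr (by omega) rfl (if_congr (by omega) rfl rfl)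
  · simp [hurwitzMat]

theorem det_hurwitzMat_congr {l : ℕ} {h h' : ℕ → F} (hh : ∀ n, n < 2 * l + 1 → h' n = h n) :
    (hurwitzMat (l + 1) h').det =
      (hurwitzMat (l + 1) h).det + (-1) ^ l * (h' (2 * l + 1) - h (2 * l + 1)) *
        ((hurwitzMat (l + 1) h).submatrix (Fin.last l).succAbove Fin.succ).det := by
  have hsub : ∀ i j : Fin (l + 1), (j : ℕ) ≠ 0 ∨ (i : ℕ) ≠ l →
      hurwitzMat (l + 1) h' i j = hurwitzMat (l + 1) h i j := by
    intro i j hij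
    have hi := i.2
    simp only [hurwitzMat, Matrix.of_apply]
    split_ifs with h1
    · exact hh _ (by omega)
    · rfl
    · rfl
  have hminor : ∀ i : Fin (l + 1), (hurwitzMat (l + 1) h').submatrix i.succAbove Fin.succ =
      (hurwitzMat (l + 1) h).submatrix i.succAbove Fin.succ := by
    intro i
    ext i' j'
    exact hsub _ _ (Or.inl (by simp))
  rw [Matrix.det_succ_column_zero, Matrix.det_succ_column_zero (hurwitzMat (l + 1) h),
    Fin.sum_univ_castSucc, Fin.sum_univ_castSucc]
  have hlast : ∀ h : ℕ → F, hurwitzMat (l + 1) h (Fin.last l) 0 = h (2 * l + 1) := fun h => by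
    simp [hurwitzMat]
  rw [Finset.sum_congr rfl fun i _ => by
    rw [hminor, hsub (Fin.castSucc i) 0 (Or.inr (by have := i.2; simp; omega))], hminor, hlast,
    hlast, Fin.val_last]
  ring

theorem hurwitzMat_congr {l : ℕ} {h h' : ℕ → F} (hh : ∀ n, n < 2 * l → h' n = h n) :
    hurwitzMat l h' = hurwitzMat l h := by
  ext i j
  have hi := i.2
  simp only [hurwitzMat, Matrix.of_apply]
  split_ifs
  · exact hh _ (by omega)
  · rfl
  · rfl

theorem card_mul_card_skip [Fintype F] (l : ℕ) :
    Fintype.card F * (univ.filter fun b : Fin (2 * l + 3) → F =>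
        (hurwitzMat (l + 2) (extFin b)).det = 0 ∧ (hurwitzMat l (extFin b)).det ≠ 0).card =
      (univ.filter fun b : Fin (2 * l + 3) → F => (hurwitzMat l (extFin b)).det ≠ 0).card := by
  let z : Fin (2 * l + 3) := Fin.last _
  let shift : (Fin (2 * l + 3) → F) → F → Fin (2 * l + 3) → F := fun b t => b + Pi.single z t
  have hshift : ∀ b t n, n < 2 * l + 3 → extFin (shift b t) n = extFin b n := by
    intro b t n hn
    simp only [extFin]
    split_ifs with h1
    · have : (⟨n - 1, by omega⟩ : Fin (2 * l + 3)) ≠ z := fun h => by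
        have := congrArg Fin.val h
        simp only [z, Fin.val_last] at this
        omega
      simp [shift, Pi.single_eq_of_ne this]
    · rfl
  have hlast : ∀ b t, extFin (shift b t) (2 * l + 3) - extFin b (2 * l + 3) = t := by
    intro b t
    have h1 := extFin_succ (shift b t) z
    have h2 := extFin_succ b z
    simp only [z, Fin.val_last] at h1 h2
    rw [h1, h2]
    simp [shift, z]
  have hD0 : ∀ b t, (hurwitzMat l (extFin (shift b t))).det = (hurwitzMat l (extFin b)).det :=
    fun b t => by rw [hurwitzMat_congr fun n hn => hshift b t n (by omega)]
  have hD : ∀ b t, (hurwitzMat (l + 2) (extFin (shift b t))).det =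
      (hurwitzMat (l + 2) (extFin b)).det + (-1) ^ (l + 1) * t *
        (hurwitzMat l (extFin b)).det := fun b t => by
    rw [det_hurwitzMat_congr fun n hn => hshift b t n (by omega), det_hurwitzMat_submatrix,
      show 2 * (l + 1) + 1 = 2 * l + 3 by ring, hlast]
  let corr : (Fin (2 * l + 3) → F) → F := fun b =>
    (-1) ^ (l + 1) * ((hurwitzMat (l + 2) (extFin b)).det / (hurwitzMat l (extFin b)).det)
  have hsq : ((-1 : F) ^ (l + 1)) * (-1) ^ (l + 1) = 1 := by
    rw [← mul_pow]
    simp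
  rw [mul_comm, ← Finset.card_univ (α := F), ← Finset.card_product]
  refine Finset.card_nbij' (fun x => shift x.1 x.2) (fun b => (shift b (-corr b), corr b))
    ?_ ?_ ?_ ?_
  · rintro ⟨b, t⟩ hb
    simp only [Finset.coe_product, Finset.coe_filter, Set.mem_prod, Set.mem_ofPred_eq,
      Finset.mem_univ, true_and] at hb ⊢
    rw [hD0]
    exact hb.1.2
  · intro b hb
    simp only [Finset.coe_product, Finset.coe_filter, Set.mem_prod, Set.mem_ofPred_eq,
      Finset.mem_univ, true_and, Finset.coe_univ, Set.mem_univ, and_true] at hb ⊢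
    rw [hD0, hD]
    refine ⟨?_, hb⟩
    simp only [corr]
    field_simp
    linear_combination -(hurwitzMat (l + 2) (extFin b)).det * hsq
  · rintro ⟨b, t⟩ hb
    simp only [Finset.coe_product, Finset.coe_filter, Set.mem_prod, Set.mem_ofPred_eq,
      Finset.mem_univ, true_and] at hb
    have hc : corr (shift b t) = t := by
      simp only [corr]
      rw [hD0, hD, hb.1.1, zero_add, mul_div_cancel_right₀ _ hb.1.2, ← mul_assoc, hsq, one_mul]
    simp only [hc]
    refine Prod.ext ?_ rfl
    simp only [shift, add_assoc, ← Pi.single_add, add_neg_cancel, Pi.single_zero, add_zero]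
  · intro b _
    simp only [shift, add_assoc, ← Pi.single_add, neg_add_cancel, Pi.single_zero, add_zero]

end Skip

/-- For `k ≥ 3`, the vanishing events for the staircases `δ_k` and `δ_{k−2}` are
independent: `P(s_{δ_k} ↦ 0 and s_{δ_{k−2}} ↦ 0) = 1/q²`. -/
theorem staircase_skip_independent (F : Type*) [Field F] [Fintype F]
    (k : ℕ) (hk : 3 ≤ k) :
    probJoint2 F k (fun i => k - i) (k - 2) (fun i => k - 2 - i)
        (max (k + (k - 1)) (k - 2 + (k - 2 - 1))) =
      1 / (Fintype.card F : ℚ) ^ 2 := by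
  obtain ⟨l, rfl⟩ : ∃ l, k = l + 2 := ⟨k - 2, by omega⟩
  have hN : max (l + 2 + (l + 2 - 1)) (l + 2 - 2 + (l + 2 - 2 - 1)) = 2 * l + 3 := by omega
  rw [hN, probJoint2, Nat.add_sub_cancel]
  have h1 := card_det_JTmat_staircase_eq_zero (F := F) (k := l + 2) (N := 2 * l + 3)
    (by omega) (by omega)
  have h2 := card_det_JTmat_staircase_eq_zero (F := F) (k := l) (N := 2 * l + 3)
    (by omega) (by omega)
  have h3 := card_mul_card_skip (F := F) l
  simp only [← det_JTmat_staircase] at h3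
  have h4 := Finset.card_filter_add_card_filter_not (s := univ) fun b : Fin (2 * l + 3) → F =>
    (JTmat F l (fun i => l - i) (extFin b)).det = 0
  have h5 := Finset.card_filter_add_card_filter_not (s := univ.filter
    fun b : Fin (2 * l + 3) → F => (JTmat F (l + 2) (fun i => l + 2 - i) (extFin b)).det = 0)
    fun b : Fin (2 * l + 3) → F => (JTmat F l (fun i => l - i) (extFin b)).det = 0
  rw [Finset.filter_filter, Finset.filter_filter] at h5
  rw [Finset.card_univ, Fintype.card_fun, Fintype.card_fin] at h4
  have hq : (Fintype.card F : ℚ) ≠ 0 := Nat.cast_ne_zero.2 Fintype.card_ne_zero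
  rw [div_eq_div_iff (pow_ne_zero _ hq) (pow_ne_zero _ hq)]
  qify at h1 h2 h3 h4 h5
  refine Eq.trans ?_ (one_mul _).symm
  linear_combination (Fintype.card F : ℚ) ^ 2 * h5 + (Fintype.card F : ℚ) * h1 + h2 -
    (Fintype.card F : ℚ) * h3 - (Fintype.card F : ℚ) * h4
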